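/- Let 0 < λ ≤ Λ and N ≥ 2 an integer with Ñ := (λ/Λ)(N−1) + 1 > 2. Assume: (a) there exists a normalized fast-decaying entire solution U at exponent p⋆ > 1, with fast-decay constant c₁ > 0 and inflection radius R₀ > 0; (b) the Dirichlet problem in the unit ball with exponent p⋆ has no positive radial solution. Let εₙ → 0⁺ with pₙ := p⋆ − εₙ > 1, and for each n let uₙ be a positive radial solution of the Dirichlet problem with exponent pₙ having a unique inflection radius r₀(n) ∈ (0,1). Then uₙ → 0 in C²_loc on (0,1]: for every r₁ ∈ (0,1), sup_{r ∈ [r₁,1]} ( uₙ(r) + |uₙ'(r)| + |uₙ''(r)| ) → 0 as n → ∞. -/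

import Mathlib

open Real Filter Set

/-- The radial Pucci maximal operator `M⁺_{λ,Λ}` applied to a radial C² function `u`
of the radial variable `r`. -/
noncomputable def radialPucci (lam Lam : ℝ) (N : ℕ) (u : ℝ → ℝ) (r : ℝ) : ℝ :=
  Lam * max (deriv (deriv u) r) 0 + lam * min (deriv (deriv u) r) 0 +
    ((N : ℝ) - 1) * (Lam * max (deriv u r / r) 0 + lam * min (deriv u r / r) 0)

/-- A positive radial solution of the Dirichlet problem `-M⁺[u] = u^q` in the unit ball. -/
def IsDirichletSol (lam Lam : ℝ) (N : ℕ) (q : ℝ) (u : ℝ → ℝ) : Prop :=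
  ContDiffOn ℝ 2 u (Set.Icc 0 1) ∧
    (∀ r ∈ Set.Ico (0 : ℝ) 1, 0 < u r) ∧
    u 1 = 0 ∧ deriv u 0 = 0 ∧
    (∀ r ∈ Set.Icc (0 : ℝ) 1, deriv u r ≤ 0) ∧
    (∀ r ∈ Set.Ioo (0 : ℝ) 1, -radialPucci lam Lam N u r = u r ^ q)

/-- `r0 ∈ (0,1)` is the (unique) inflection radius of `u` in the unit ball. -/
def InflectionAt (u : ℝ → ℝ) (r0 : ℝ) : Prop :=
  r0 ∈ Set.Ioo (0 : ℝ) 1 ∧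
    (∀ r ∈ Set.Ico (0 : ℝ) r0, deriv (deriv u) r < 0) ∧
    deriv (deriv u) r0 = 0 ∧
    (∀ r ∈ Set.Ioo r0 (1 : ℝ), 0 < deriv (deriv u) r)

/-- A normalized fast-decaying entire radial solution of `-M⁺[U] = U^{p⋆}` in `ℝ^N`,
with fast-decay constant `c1` and inflection radius `R0`. -/
def IsEntireSol (lam Lam : ℝ) (N : ℕ) (Ntil pstar c1 R0 : ℝ) (U : ℝ → ℝ) : Prop :=
  ContDiffOn ℝ 2 U (Set.Ici 0) ∧
    (∀ r : ℝ, 0 ≤ r → 0 < U r) ∧ U 0 = 1 ∧ deriv U 0 = 0 ∧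
    (∀ r : ℝ, 0 < r → deriv U r < 0) ∧
    (∀ r : ℝ, 0 < r → -radialPucci lam Lam N U r = U r ^ pstar) ∧
    0 < R0 ∧
    (∀ r ∈ Set.Ico (0 : ℝ) R0, deriv (deriv U) r < 0) ∧
    deriv (deriv U) R0 = 0 ∧
    (∀ r : ℝ, R0 < r → 0 < deriv (deriv U) r) ∧
    0 < c1 ∧
    Filter.Tendsto (fun r : ℝ => r ^ (Ntil - 2) * U r) Filter.atTop (nhds c1) ∧
    Filter.Tendsto (fun r : ℝ => r ^ (Ntil - 1) * deriv U r) Filter.atTop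
      (nhds (-(Ntil - 2) * c1))

/-- The barrier inequality on the curve `y = m z + w`. -/
lemma emden_barrier_algebra {D P p g m μ κ y z w : ℝ} (hp : 1 < p) (hpP : p ≤ P)
    (hPg : P * g ≤ D + 2) (hm : m * (2 * D + 3) = 2) (hm0 : 0 < m)
    (hμ : 0 < μ) (hμD : 4 * μ = D - g) (hκ : κ < 2 * μ * (1 / (2 * P) - m * κ))
    (hz : 0 < z) (hzκ : z ≤ κ) (hyg : y ≤ g) (hy : 0 < y) (hw : 0 < w)
    (h : y = m * z + w) :
    y * (y - D) + z < (m * z - μ * w) * (2 - (p - 1) * y) := by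
  have e1 : y * (y - D) + z - (m * z - μ * w) * (2 - (p - 1) * y)
      = z * (m * (p * y - (D + 2)) + 1) + w * (y - D + 2 * μ - μ * (p - 1) * y) := by
    linear_combination (y - D) * h
  have e2 : w * (y - D + 2 * μ - μ * (p - 1) * y) ≤ w * (-(2 * μ)) := by
    apply mul_le_mul_of_nonneg_left _ hw.le
    have : 0 ≤ μ * (p - 1) * y := by
      have : 0 < p - 1 := by linarith
      positivity
    linarith
  have hyP : p * y ≤ P * y := by gcongr
  have e0 : 0 < w * (2 * μ) := by positivity
  rcases le_or_gt (p * y) (1 / 2) with h4 | h4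
  · have h5 := mul_le_mul_of_nonneg_left h4 hm0.le
    have h6 : m * (p * y - (D + 2)) + 1 ≤ 0 := by linarith
    have := mul_nonpos_of_nonneg_of_nonpos hz.le h6
    linarith
  · have h5 : P * y ≤ P * g := by gcongr; linarith
    have h6 : m * (p * y - (D + 2)) ≤ 0 :=
      mul_nonpos_of_nonneg_of_nonpos hm0.le (by linarith)
    have h7 := mul_nonpos_of_nonneg_of_nonpos hz.le h6
    have h8 : 1 / (2 * P) < y := by
      rw [div_lt_iff₀ (by linarith)]
      linarith
    have h9 : m * z ≤ m * κ := by gcongr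
    have h10 : 1 / (2 * P) - m * κ < w := by linarith
    have h11 := mul_lt_mul_of_pos_left h10 (by positivity : 0 < 2 * μ)
    linarith

/-- Lyapunov barrier for the Emden–Fowler phase plane `y = -r u'/u`, `z = r² u^(p-1) / Λ`:
a convex orbit which enters with small `z` keeps `z` small. -/
lemma emden_phase_plane_lt {D P p g m μ κ η a b : ℝ} {y z : ℝ → ℝ}
    (hD : 0 < D) (hp : 1 < p) (hpP : p ≤ P) (hg : 0 < g) (hPg : P * g ≤ D + 2)
    (hpg : 2 < (p - 1) * g) (hm : m * (2 * D + 3) = 2)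
    (hμ : 0 < μ) (hμD : 4 * μ = D - g) (hκ : 0 < κ)
    (hκ1 : κ < g * (D - g)) (hκ2 : κ < 2 * μ * (1 / (2 * P) - m * κ))
    (hηκ : η < κ) (hη : m * κ + g * (η / κ) ^ μ < κ / (D + 1))
    (ha : 0 < a) (hab : a ≤ b)
    (hy : ∀ r ∈ Icc a b, HasDerivAt y ((y r * (y r - D) + z r) / r) r)
    (hz : ∀ r ∈ Icc a b, HasDerivAt z (z r * (2 - (p - 1) * y r) / r) r)
    (hz0 : ∀ r ∈ Icc a b, 0 < z r) (hc : ∀ r ∈ Icc a b, z r ≤ (D + 1) * y r)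
    (hza : z a ≤ η) : z b < κ := by
  by_contra hzb
  push Not at hzb
  have hyc : ContinuousOn y (Icc a b) := fun r hr => (hy r hr).continuousAt.continuousWithinAt
  have hzc : ContinuousOn z (Icc a b) := fun r hr => (hz r hr).continuousAt.continuousWithinAt
  -- first radius at which `z` reaches `κ`
  obtain ⟨c, ⟨hcab, hzc'⟩, hcmin⟩ : ∃ c, IsLeast (Icc a b ∩ z ⁻¹' Ici κ) c :=
    (isCompact_Icc.of_isClosed_subset (hzc.preimage_isClosed_of_isClosed isClosed_Icc isClosed_Ici)
      inter_subset_left).exists_isLeast ⟨b, right_mem_Icc.2 hab, hzb⟩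
  have hzc' : κ ≤ z c := hzc'
  have hsub : Icc a c ⊆ Icc a b := Icc_subset_Icc_right hcab.2
  have hzlt : ∀ r ∈ Ico a c, z r < κ := by
    intro r hr
    by_contra h
    push Not at h
    exact absurd (hcmin ⟨hsub ⟨hr.1, hr.2.le⟩, h⟩) (not_le.2 hr.2)
  -- first radius at which `y ≤ g`
  have hex : (Icc a c ∩ y ⁻¹' Iic g).Nonempty := by
    by_contra hne
    rw [not_nonempty_iff_eq_empty] at hne
    have hyg : ∀ r ∈ Icc a c, g < y r := by
      intro r hr
      by_contra h
      push Not at h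
      have : r ∈ Icc a c ∩ y ⁻¹' Iic g := ⟨hr, h⟩
      rw [hne] at this
      exact this
    have : AntitoneOn z (Icc a c) := by
      refine antitoneOn_of_deriv_nonpos (convex_Icc a c) (hzc.mono hsub)
        (fun r hr => ?_) (fun r hr => ?_)
      · exact (hz r (hsub (interior_subset hr))).differentiableAt.differentiableWithinAt
      · have hr := interior_subset hr
        rw [(hz r (hsub hr)).deriv]
        have h1 := hyg r hr
        have h2 := hz0 r (hsub hr)
        have h3 : 0 < r := ha.trans_le hr.1
        apply div_nonpos_of_nonpos_of_nonneg _ h3.le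
        apply mul_nonpos_of_nonneg_of_nonpos h2.le
        nlinarith
    have := this (left_mem_Icc.2 hcab.1) (right_mem_Icc.2 hcab.1) hcab.1
    linarith
  obtain ⟨e, ⟨heac, hye⟩, hemin⟩ : ∃ e, IsLeast (Icc a c ∩ y ⁻¹' Iic g) e :=
    (isCompact_Icc.of_isClosed_subset
      ((hyc.mono hsub).preimage_isClosed_of_isClosed isClosed_Icc isClosed_Iic)
      inter_subset_left).exists_isLeast hex
  have hye : y e ≤ g := hye
  have hze : z e ≤ η := by
    have : AntitoneOn z (Icc a e) := by
      have hs : Icc a e ⊆ Icc a b := (Icc_subset_Icc_right heac.2).trans hsub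
      refine antitoneOn_of_deriv_nonpos (convex_Icc a e) (hzc.mono hs)
        (fun r hr => ?_) (fun r hr => ?_)
      · exact (hz r (hs (interior_subset hr))).differentiableAt.differentiableWithinAt
      · rw [interior_Icc] at hr
        have hr' := hs (Ioo_subset_Icc_self hr)
        rw [(hz r hr').deriv]
        have h1 : g < y r := by
          by_contra h
          push Not at h
          exact absurd (hemin ⟨⟨hr.1.le, hr.2.le.trans heac.2⟩, h⟩) (not_le.2 hr.2)
        have h2 := hz0 r hr'
        have h3 : 0 < r := ha.trans hr.1
        apply div_nonpos_of_nonpos_of_nonneg _ h3.le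
        apply mul_nonpos_of_nonneg_of_nonpos h2.le
        nlinarith
    exact (this (left_mem_Icc.2 heac.1) (right_mem_Icc.2 heac.1) heac.1).trans hza
  have hec : e ≤ c := heac.2
  have hs : Icc e c ⊆ Icc a b := (Icc_subset_Icc_left heac.1).trans hsub
  have hzlt' : ∀ r ∈ Ico e c, z r < κ := fun r hr => hzlt r ⟨heac.1.trans hr.1, hr.2⟩
  have hdg : 0 < D - g := by linarith
  have hyg : ∀ r ∈ Icc e c, y r ≤ g := by
    refine image_le_of_deriv_right_lt_deriv_boundary' (B := fun _ => g) (B' := fun _ => 0)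
      (hyc.mono hs) (fun r hr => (hy r (hs (Ico_subset_Icc_self hr))).hasDerivWithinAt) hye
      continuousOn_const (fun r _ => (hasDerivAt_const r g).hasDerivWithinAt) ?_
    intro r hr h
    have h3 : 0 < r := ha.trans_le (heac.1.trans hr.1)
    have := hzlt' r hr
    apply div_neg_of_neg_of_pos _ h3
    rw [h]
    nlinarith
  have hze0 : 0 < z e := hz0 e (hs (left_mem_Icc.2 hec))
  have hm0 : 0 < m := by
    by_contra h
    push Not at h
    nlinarith
  have hB : ∀ r ∈ Icc e c, HasDerivAt (fun t => m * z t + g * z e ^ μ * z t ^ (-μ))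
      (m * (z r * (2 - (p - 1) * y r) / r) + g * z e ^ μ *
        ((z r * (2 - (p - 1) * y r) / r) * (-μ) * z r ^ (-μ - 1))) r := by
    intro r hr
    have h1 := hz r (hs hr)
    exact (h1.const_mul m).add
      ((h1.rpow_const (Or.inl (hz0 r (hs hr)).ne')).const_mul (g * z e ^ μ))
  have hyB : ∀ r ∈ Icc e c, y r ≤ m * z r + g * z e ^ μ * z r ^ (-μ) := by
    refine image_le_of_deriv_right_lt_deriv_boundary'
      (hyc.mono hs) (fun r hr => (hy r (hs (Ico_subset_Icc_self hr))).hasDerivWithinAt) ?_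
      (fun r hr => (hB r hr).continuousAt.continuousWithinAt)
      (fun r hr => (hB r (Ico_subset_Icc_self hr)).hasDerivWithinAt) ?_
    · rw [mul_assoc, ← rpow_add hze0, add_neg_cancel, rpow_zero]
      nlinarith
    · intro r hr h
      have hr' := Ico_subset_Icc_self hr
      have h3 : 0 < r := ha.trans_le (heac.1.trans hr.1)
      have hzr := hz0 r (hs hr')
      have hzk := hzlt' r hr
      have hyr := hyg r hr'
      have hcr := hc r (hs hr')
      have hy0 : 0 < y r := by
        by_contra hh
        push Not at hh
        nlinarith
      rw [rpow_sub_one hzr.ne']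
      set w := g * z e ^ μ * z r ^ (-μ) with hw
      have hw0 : 0 < w := by positivity
      have key := emden_barrier_algebra hp hpP hPg hm hm0 hμ hμD hκ2 hzr hzk.le hyr hy0 hw0 h
      have e3 : m * (z r * (2 - (p - 1) * y r) / r) + g * z e ^ μ *
          ((z r * (2 - (p - 1) * y r) / r) * (-μ) * (z r ^ (-μ) / z r))
          = (m * z r - μ * w) * (2 - (p - 1) * y r) / r := by
        rw [hw]
        field_simp
        ring
      rw [e3]
      exact div_lt_div_of_pos_right key h3
  have hc1 := hyB c (right_mem_Icc.2 hec)
  have hzck : z c = κ := by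
    refine le_antisymm ?_ hzc'
    rcases hec.eq_or_lt with h | h
    · rw [← h]; linarith
    · refine le_of_tendsto (x := nhdsWithin c (Iio c))
        ((hz c hcab).continuousAt.tendsto.mono_left nhdsWithin_le_nhds) ?_
      filter_upwards [Ico_mem_nhdsLT h] with r hr using (hzlt' r hr).le
  have hc2 := hc c hcab
  rw [hzck] at hc1 hc2
  have h1 : g * z e ^ μ * κ ^ (-μ) ≤ g * (η / κ) ^ μ := by
    rw [rpow_neg hκ.le, mul_assoc, ← div_eq_mul_inv, ← div_rpow hze0.le hκ.le]
    gcongr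
  have h2 : κ / (D + 1) ≤ y c := by
    rw [div_le_iff₀ (by linarith)]
    linarith
  linarith

/-- The scalar Pucci extremal function is `lam`-strongly increasing. -/
lemma pucci_scalar_mono {lam Lam a b : ℝ} (hlL : lam ≤ Lam) (hab : b ≤ a) :
    lam * (a - b) ≤ (Lam * max a 0 + lam * min a 0) - (Lam * max b 0 + lam * min b 0) := by
  have ha : max a 0 + min a 0 = a := by simp
  have hb : max b 0 + min b 0 = b := by simp
  have h : max b 0 ≤ max a 0 := max_le_max_right 0 hab
  have : lam * (a - b) = lam * (max a 0 + min a 0) - lam * (max b 0 + min b 0) := by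
    rw [ha, hb]; ring
  rw [this]
  nlinarith [mul_le_mul_of_nonneg_right hlL (sub_nonneg.2 h)]

/-- Closeness of powers on the unit interval. -/
lemma abs_rpow_sub_rpow_le {P e x y : ℝ} (he : 0 ≤ e) (hp : 1 ≤ P - e)
    (hx0 : 0 ≤ x) (hx1 : x ≤ 1) (hy0 : 0 ≤ y) (hy1 : y ≤ 1) :
    |x ^ (P - e) - y ^ P| ≤ P * |x - y| + e := by
  have h1 : |x ^ (P - e) - y ^ (P - e)| ≤ (P - e) * |x - y| := by
    have := Convex.norm_image_sub_le_of_norm_deriv_le (𝕜 := ℝ) (f := fun t : ℝ => t ^ (P - e))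
      (C := P - e) (s := Icc 0 1) (x := y) (y := x)
      (fun t _ => (hasDerivAt_rpow_const (Or.inr hp)).differentiableAt) (fun t ht => ?_)
      (convex_Icc 0 1) ⟨hy0, hy1⟩ ⟨hx0, hx1⟩
    · simpa using this
    · rw [(hasDerivAt_rpow_const (Or.inr hp)).deriv, norm_mul, Real.norm_eq_abs, Real.norm_eq_abs,
        abs_of_nonneg (by linarith), abs_of_nonneg (rpow_nonneg ht.1 _)]
      have := rpow_le_one ht.1 ht.2 (by linarith : 0 ≤ P - e - 1)
      nlinarith
  have h2 : |y ^ (P - e) - y ^ P| ≤ e := by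
    rcases hy0.eq_or_lt with rfl | hy
    · rw [zero_rpow (by linarith), zero_rpow (by linarith)]
      simpa using he
    · have e1 : y ^ P ≤ y ^ (P - e) := rpow_le_rpow_of_exponent_ge hy hy1 (by linarith)
      rw [abs_of_nonneg (by linarith)]
      have e2 : y ^ P = y ^ (P - e) * y ^ e := by rw [← rpow_add hy]; ring_nf
      have e3 : 1 + e * log y ≤ y ^ e := by
        rw [rpow_def_of_pos hy]
        have := add_one_le_exp (log y * e)
        linarith
      have e4 : y ^ (P - e) ≤ y := by
        simpa using rpow_le_rpow_of_exponent_ge hy hy1 hp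
      have e5 : y * (-log y) ≤ 1 := by
        have := add_one_le_exp (-log y)
        have h := exp_log hy
        rw [exp_neg, h] at this
        have h3 : y * (-log y + 1) ≤ y * y⁻¹ := by gcongr
        rw [mul_inv_cancel₀ hy.ne'] at h3
        linarith
      have e6 : 0 ≤ -log y := by linarith [log_nonpos hy0 hy1]
      have e7 : 0 ≤ y ^ (P - e) := by positivity
      calc y ^ (P - e) - y ^ P = y ^ (P - e) * (1 - y ^ e) := by rw [e2]; ring
        _ ≤ y ^ (P - e) * (e * -log y) := by gcongr; linarith
        _ ≤ y * (e * -log y) := by gcongr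
        _ = e * (y * -log y) := by ring
        _ ≤ e * 1 := by gcongr
        _ = e := by ring
  have h3 := abs_sub_le (x ^ (P - e)) (y ^ (P - e)) (y ^ P)
  have h4 : 0 ≤ e * |x - y| := by positivity
  linarith

/-- Two solutions of the radial equation with nearby exponents and equal data at the origin
stay close; the singular first order term has the good sign. -/
lemma radial_energy_le {lam Lam k P e b : ℝ} {v v1 v2 U U1 U2 : ℝ → ℝ}
    (hlam : 0 < lam) (hlL : lam ≤ Lam) (hk : 0 ≤ k) (he : 0 ≤ e) (hp : 1 ≤ P - e)
    (hvc : ContinuousOn v (Ico 0 b)) (hv1c : ContinuousOn v1 (Ico 0 b))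
    (hUc : ContinuousOn U (Ico 0 b)) (hU1c : ContinuousOn U1 (Ico 0 b))
    (hv : ∀ r ∈ Ioo 0 b, HasDerivAt v (v1 r) r) (hv1 : ∀ r ∈ Ioo 0 b, HasDerivAt v1 (v2 r) r)
    (hU : ∀ r ∈ Ioo 0 b, HasDerivAt U (U1 r) r) (hU1 : ∀ r ∈ Ioo 0 b, HasDerivAt U1 (U2 r) r)
    (h0 : v 0 = U 0) (h01 : v1 0 = U1 0)
    (hvb : ∀ r ∈ Ioo 0 b, v r ∈ Icc (0 : ℝ) 1) (hUb : ∀ r ∈ Ioo 0 b, U r ∈ Icc (0 : ℝ) 1)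
    (hve : ∀ r ∈ Ioo 0 b, Lam * max (v2 r) 0 + lam * min (v2 r) 0 + k * lam * (v1 r / r)
      = -v r ^ (P - e))
    (hUe : ∀ r ∈ Ioo 0 b, Lam * max (U2 r) 0 + lam * min (U2 r) 0 + k * lam * (U1 r / r)
      = -U r ^ P) :
    ∀ r ∈ Ico 0 b, (v r - U r) ^ 2 + (v1 r - U1 r) ^ 2
      ≤ e ^ 2 * exp ((1 + P / lam + 1 / lam ^ 2) * r) := by
  set K := 1 + P / lam + 1 / lam ^ 2 with hK
  have hP : 0 < P := by linarith
  have hK1 : 1 ≤ K := by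
    have : 0 < P / lam + 1 / lam ^ 2 := by positivity
    linarith
  set E : ℝ → ℝ := fun r => (v r - U r) ^ 2 + (v1 r - U1 r) ^ 2 with hE
  set E' : ℝ → ℝ := fun r => 2 * (v r - U r) * (v1 r - U1 r)
    + 2 * (v1 r - U1 r) * (v2 r - U2 r) with hE'
  have hEd : ∀ r ∈ Ioo 0 b, HasDerivAt E (E' r) r := by
    intro r hr
    have h1 := (((hv r hr).sub (hU r hr)).pow 2).add (((hv1 r hr).sub (hU1 r hr)).pow 2)
    refine h1.congr_deriv ?_
    simp [hE']
  have hbound : ∀ r ∈ Ioo 0 b, E' r ≤ K * E r + e ^ 2 := by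
    intro r hr
    have hpow := abs_rpow_sub_rpow_le he hp (hvb r hr).1 (hvb r hr).2 (hUb r hr).1 (hUb r hr).2
    have q1 := hve r hr
    have q2 := hUe r hr
    set w := v r - U r
    set w1 := v1 r - U1 r with hw1
    set h := P * |w| + e with hh
    have hh0 : 0 ≤ h := by positivity
    have hquot : v1 r / r - U1 r / r = w1 / r := by rw [hw1]; ring
    have hkey : lam * (w1 * (v2 r - U2 r)) ≤ |w1| * h := by
      have habs := abs_le.1 hpow
      rcases le_total 0 w1 with hw | hw
      · rcases le_total (U2 r) (v2 r) with h2 | h2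
        · have m1 := pucci_scalar_mono hlL h2
          have m2 : 0 ≤ k * lam * (w1 / r) :=
            mul_nonneg (by positivity) (div_nonneg hw hr.1.le)
          rw [← hquot] at m2
          have m3 : lam * (v2 r - U2 r) ≤ h := by linarith [habs.1]
          rw [abs_of_nonneg hw]
          have := mul_le_mul_of_nonneg_left m3 hw
          linarith
        · have : w1 * (v2 r - U2 r) ≤ 0 := mul_nonpos_of_nonneg_of_nonpos hw (by linarith)
          exact (mul_nonpos_of_nonneg_of_nonpos hlam.le this).trans (by positivity)
      · rcases le_total (U2 r) (v2 r) with h2 | h2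
        · have : w1 * (v2 r - U2 r) ≤ 0 := mul_nonpos_of_nonpos_of_nonneg hw (by linarith)
          exact (mul_nonpos_of_nonneg_of_nonpos hlam.le this).trans (by positivity)
        · have m1 := pucci_scalar_mono hlL h2
          have m2 : k * lam * (w1 / r) ≤ 0 :=
            mul_nonpos_of_nonneg_of_nonpos (by positivity) (div_nonpos_of_nonpos_of_nonneg hw hr.1.le)
          rw [← hquot] at m2
          have m3 : lam * (U2 r - v2 r) ≤ h := by linarith [habs.2]
          rw [abs_of_nonpos hw]
          have := mul_le_mul_of_nonneg_left m3 (neg_nonneg.2 hw)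
          linarith
    have hkey2 : w1 * (v2 r - U2 r) ≤ |w1| * h / lam := by
      rw [le_div_iff₀ hlam]; linarith
    have t1 : 2 * w * w1 ≤ w ^ 2 + w1 ^ 2 := two_mul_le_add_sq w w1
    have t2 : 2 * (|w1| * h / lam) ≤ P / lam * (w ^ 2 + w1 ^ 2) + w1 ^ 2 / lam ^ 2 + e ^ 2 := by
      have s1 : 2 * |w| * |w1| ≤ w ^ 2 + w1 ^ 2 := by
        have := two_mul_le_add_sq |w| |w1|
        simpa using this
      have s2 : 2 * (|w1| / lam) * e ≤ w1 ^ 2 / lam ^ 2 + e ^ 2 := by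
        have := two_mul_le_add_sq (|w1| / lam) e
        simpa [div_pow] using this
      have s3 : P / lam * (2 * |w| * |w1|) ≤ P / lam * (w ^ 2 + w1 ^ 2) := by gcongr
      have : 2 * (|w1| * h / lam) = P / lam * (2 * |w| * |w1|) + 2 * (|w1| / lam) * e := by
        rw [hh]; field_simp
      linarith
    have : K * E r = w ^ 2 + w1 ^ 2 + P / lam * (w ^ 2 + w1 ^ 2) + w1 ^ 2 / lam ^ 2
        + w ^ 2 / lam ^ 2 := by
      simp only [hK, hE]; ring
    rw [this]
    have : 0 ≤ w ^ 2 / lam ^ 2 := by positivity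
    change 2 * w * w1 + 2 * w1 * (v2 r - U2 r) ≤ _
    linarith
  have hanti : AntitoneOn (fun r => (E r + e ^ 2) * exp (-K * r)) (Ico 0 b) := by
    refine antitoneOn_of_deriv_nonpos (convex_Ico 0 b) ?_ ?_ ?_
    · have : ContinuousOn E (Ico 0 b) :=
        ((hvc.sub hUc).pow 2).add ((hv1c.sub hU1c).pow 2)
      fun_prop
    all_goals
      intro r hr
      rw [interior_Ico] at hr
      have hd := ((hEd r hr).add_const (e ^ 2)).mul
        (((hasDerivAt_id r).const_mul (-K)).exp)
      simp only [id, mul_one] at hd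
    · exact hd.differentiableAt.differentiableWithinAt
    · refine (le_of_eq hd.deriv).trans ?_
      have := hbound r hr
      have h2 : (E' r - K * (E r + e ^ 2)) * exp (-K * r) ≤ 0 := by
        apply mul_nonpos_of_nonpos_of_nonneg _ (exp_pos _).le
        nlinarith [sq_nonneg e]
      linarith
  intro r hr
  have h1 := hanti (left_mem_Ico.2 (hr.1.trans_lt hr.2)) hr hr.1
  have hE0 : E 0 = 0 := by simp [hE, h0, h01]
  simp only [hE0, mul_zero, exp_zero, zero_add, mul_one] at h1
  have h2 : E r + e ^ 2 ≤ e ^ 2 * exp (K * r) := by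
    rw [neg_mul, exp_neg, ← div_eq_mul_inv, div_le_iff₀ (exp_pos _)] at h1
    exact h1
  have : E r ≤ e ^ 2 * exp (K * r) := by linarith [sq_nonneg e]
  exact this

lemma radialPucci_of_deriv_nonpos {lam Lam : ℝ} {N : ℕ} {u : ℝ → ℝ} {r : ℝ} (hr : 0 < r)
    (h : deriv u r ≤ 0) :
    radialPucci lam Lam N u r = Lam * max (deriv (deriv u) r) 0 +
      lam * min (deriv (deriv u) r) 0 + ((N : ℝ) - 1) * lam * (deriv u r / r) := by
  have h1 : deriv u r / r ≤ 0 := div_nonpos_of_nonpos_of_nonneg h hr.le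
  rw [radialPucci, max_eq_right h1, min_eq_left h1]
  ring

lemma hasDerivAt_deriv_of_contDiffOn {u : ℝ → ℝ} {s : Set ℝ} (hu : ContDiffOn ℝ 2 u s) {r : ℝ}
    (hr : s ∈ nhds r) :
    HasDerivAt u (deriv u r) r ∧ HasDerivAt (deriv u) (deriv (deriv u) r) r := by
  have h := hu.contDiffAt hr
  exact ⟨(h.differentiableAt (by norm_num)).hasDerivAt,
    ((h.derivWithin (m := 1) (by norm_num)).differentiableAt (by norm_num)).hasDerivAt⟩

/-- A bound on the derivative to the left of `b` bounds the two-sided derivative at `b`. -/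
lemma abs_deriv_le_of_left {f : ℝ → ℝ} {a b M : ℝ} (hab : a < b) (hM0 : 0 ≤ M)
    (hd : ∀ r ∈ Ioo a b, DifferentiableAt ℝ f r) (hM : ∀ r ∈ Ioo a b, |deriv f r| ≤ M) :
    |deriv f b| ≤ M := by
  by_cases h : DifferentiableAt ℝ f b
  · have hlip : ∀ r ∈ Ioo a b, |slope f b r| ≤ M := by
      intro r hr
      have hc : ContinuousOn f (Icc r b) := by
        intro t ht
        rcases ht.2.eq_or_lt with h1 | h1
        · rw [h1]; exact h.continuousAt.continuousWithinAt
        · exact (hd t ⟨hr.1.trans_le ht.1, h1⟩).continuousAt.continuousWithinAt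
      obtain ⟨c, hc, hce⟩ := exists_deriv_eq_slope f hr.2 hc
        (fun t ht => (hd t ⟨hr.1.trans ht.1, ht.2⟩).differentiableWithinAt)
      have : slope f b r = deriv f c := by
        rw [slope_comm, hce, slope_def_field]
      rw [this]
      exact hM c ⟨hr.1.trans hc.1, hc.2⟩
    have ht : Tendsto (fun r => |slope f b r|) (nhdsWithin b (Iio b)) (nhds |deriv f b|) :=
      (h.hasDerivAt.tendsto_slope.mono_left (nhdsWithin_mono b (fun x hx => ne_of_lt hx))).abs
    refine le_of_tendsto ht ?_
    filter_upwards [Ioo_mem_nhdsLT hab] with r hr using hlip r hr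
  · rw [deriv_zero_of_not_differentiableAt h]
    simpa using hM0

namespace IsDirichletSol

variable {lam Lam q : ℝ} {N : ℕ} {u : ℝ → ℝ}

lemma hasDerivAt (h : IsDirichletSol lam Lam N q u) {r : ℝ} (hr : r ∈ Ioo (0 : ℝ) 1) :
    HasDerivAt u (deriv u r) r :=
  (hasDerivAt_deriv_of_contDiffOn h.1 (Icc_mem_nhds hr.1 hr.2)).1

lemma hasDerivAt_deriv (h : IsDirichletSol lam Lam N q u) {r : ℝ} (hr : r ∈ Ioo (0 : ℝ) 1) :
    HasDerivAt (deriv u) (deriv (deriv u) r) r :=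
  (hasDerivAt_deriv_of_contDiffOn h.1 (Icc_mem_nhds hr.1 hr.2)).2

lemma equation (h : IsDirichletSol lam Lam N q u) {r : ℝ} (hr : r ∈ Ioo (0 : ℝ) 1) :
    Lam * max (deriv (deriv u) r) 0 + lam * min (deriv (deriv u) r) 0 +
      ((N : ℝ) - 1) * lam * (deriv u r / r) = -u r ^ q := by
  have h1 := h.2.2.2.2.2 r hr
  rw [radialPucci_of_deriv_nonpos hr.1 (h.2.2.2.2.1 r (Ioo_subset_Icc_self hr))] at h1
  linarith

lemma antitoneOn (h : IsDirichletSol lam Lam N q u) : AntitoneOn u (Icc 0 1) := by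
  refine antitoneOn_of_deriv_nonpos (convex_Icc 0 1) h.1.continuousOn ?_ ?_
  all_goals
    intro r hr
    rw [interior_Icc] at hr
  · exact (h.hasDerivAt hr).differentiableAt.differentiableWithinAt
  · exact h.2.2.2.2.1 r (Ioo_subset_Icc_self hr)

/-- In the convexity region the equation is a Lane–Emden equation in dimension `D + 2`. -/
lemma convex_equation (h : IsDirichletSol lam Lam N q u) (hLam : 0 < Lam) {D r : ℝ}
    (hD : D + 1 = lam / Lam * ((N : ℝ) - 1)) (hr : r ∈ Ioo (0 : ℝ) 1)
    (hc : 0 < deriv (deriv u) r) :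
    deriv (deriv u) r = -((D + 1) * (deriv u r / r)) - u r ^ q / Lam := by
  have h1 := h.equation hr
  rw [max_eq_left hc.le, min_eq_right hc.le] at h1
  rw [hD]
  field_simp at h1 ⊢
  linarith

/-- Smallness of the scale invariant quantity `r² u^(q-1)` propagates through the convexity
region. -/
lemma scale_invariant_lt (h : IsDirichletSol lam Lam N q u) (hLam : 0 < Lam)
    {D P g m μ κ η a b : ℝ} (hDdef : D + 1 = lam / Lam * ((N : ℝ) - 1))
    (hD : 0 < D) (hp : 1 < q) (hpP : q ≤ P) (hg : 0 < g) (hPg : P * g ≤ D + 2)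
    (hpg : 2 < (q - 1) * g) (hm : m * (2 * D + 3) = 2)
    (hμ : 0 < μ) (hμD : 4 * μ = D - g) (hκ : 0 < κ)
    (hκ1 : κ < g * (D - g)) (hκ2 : κ < 2 * μ * (1 / (2 * P) - m * κ))
    (hηκ : η < κ) (hη : m * κ + g * (η / κ) ^ μ < κ / (D + 1))
    (ha : 0 < a) (hab : a ≤ b) (hb : b < 1)
    (hconv : ∀ r ∈ Icc a b, 0 < deriv (deriv u) r)
    (hza : a ^ 2 * u a ^ (q - 1) / Lam ≤ η) : b ^ 2 * u b ^ (q - 1) / Lam < κ := by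
  have hmem : ∀ r ∈ Icc a b, r ∈ Ioo (0 : ℝ) 1 := fun r hr =>
    ⟨ha.trans_le hr.1, hr.2.trans_lt hb⟩
  have hpos : ∀ r ∈ Icc a b, 0 < u r := fun r hr => h.2.1 r ⟨(hmem r hr).1.le, (hmem r hr).2⟩
  refine emden_phase_plane_lt (y := fun r => -(r * deriv u r) / u r)
    (z := fun r => r ^ 2 * u r ^ (q - 1) / Lam) hD hp hpP hg hPg hpg hm hμ hμD hκ hκ1 hκ2 hηκ hη
    ha hab ?_ ?_ ?_ ?_ hza
  · intro r hr
    have hr' := hmem r hr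
    have hr0 := hr'.1
    have hur := hpos r hr
    have h1 := ((((hasDerivAt_id r).mul (h.hasDerivAt_deriv hr')).neg).div
      (h.hasDerivAt hr') hur.ne')
    refine h1.congr_deriv ?_
    rw [h.convex_equation hLam hDdef hr' (hconv r hr)]
    have : u r ^ q = u r ^ (q - 1) * u r := by
      rw [rpow_sub_one hur.ne']; field_simp
    rw [this]
    simp only [Pi.neg_apply, Pi.mul_apply, id]
    field_simp
    ring
  · intro r hr
    have hr' := hmem r hr
    have hr0 := hr'.1
    have hur := hpos r hr
    have h1 := (((hasDerivAt_pow 2 r).mul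
      ((h.hasDerivAt hr').rpow_const (p := q - 1) (Or.inl hur.ne'))).div_const Lam)
    refine h1.congr_deriv ?_
    rw [rpow_sub_one hur.ne' (q - 1)]
    simp only [Nat.cast_ofNat]
    field_simp
    ring
  · intro r hr
    have := hpos r hr
    have := (hmem r hr).1
    positivity
  · intro r hr
    have hr' := hmem r hr
    have hr0 := hr'.1
    have hur := hpos r hr
    have h1 := hconv r hr
    rw [h.convex_equation hLam hDdef hr' h1] at h1
    have : u r ^ q = u r ^ (q - 1) * u r := by
      rw [rpow_sub_one hur.ne']; field_simp
    rw [this] at h1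
    have h2 : 0 < r ^ 2 / u r * (-((D + 1) * (deriv u r / r)) - u r ^ (q - 1) * u r / Lam) := by
      positivity
    have h3 : r ^ 2 / u r * (-((D + 1) * (deriv u r / r)) - u r ^ (q - 1) * u r / Lam)
        = (D + 1) * (-(r * deriv u r) / u r) - r ^ 2 * u r ^ (q - 1) / Lam := by
      field_simp
    linarith

/-- In the convexity region the `C²` size of `u` on `[2a, 1]` is controlled by `u a`. -/
lemma sum_le (h : IsDirichletSol lam Lam N q u) (hLam : 0 < Lam)
    {D a : ℝ} (hDdef : D + 1 = lam / Lam * ((N : ℝ) - 1)) (hD : 0 < D)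
    (ha : 0 < a) (ha1 : 2 * a < 1) (hconv : ∀ r ∈ Ico a 1, 0 < deriv (deriv u) r) :
    ∀ r ∈ Icc (2 * a) 1, u r + |deriv u r| + |deriv (deriv u) r|
      ≤ u a * (1 + 1 / a + (D + 1) / a ^ 2) := by
  have hmem : ∀ r ∈ Ico a 1, r ∈ Ioo (0 : ℝ) 1 := fun r hr => ⟨ha.trans_le hr.1, hr.2⟩
  have hua : 0 < u a := h.2.1 a ⟨ha.le, by linarith⟩
  have hmono : MonotoneOn (deriv u) (Ico a 1) := by
    refine monotoneOn_of_deriv_nonneg (convex_Ico a 1)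
      (fun r hr => (h.hasDerivAt_deriv (hmem r hr)).continuousAt.continuousWithinAt) ?_ ?_
    all_goals
      intro r hr
      have hr := interior_subset hr
    · exact (h.hasDerivAt_deriv (hmem r hr)).differentiableAt.differentiableWithinAt
    · exact (hconv r hr).le
  have hd1 : ∀ r ∈ Ico (2 * a) 1, |deriv u r| ≤ u a / a := by
    intro r hr
    have har : a < r := by linarith [hr.1]
    obtain ⟨c, hc, hce⟩ := exists_deriv_eq_slope u har
      (h.1.continuousOn.mono (Icc_subset_Icc ha.le hr.2.le))
      (fun t ht => (h.hasDerivAt ⟨ha.trans ht.1, ht.2.trans hr.2⟩).differentiableAt.differentiableWithinAt)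
    have h1 := hmono ⟨hc.1.le, hc.2.trans hr.2⟩ ⟨har.le, hr.2⟩ hc.2.le
    have h2 := h.2.2.2.2.1 r ⟨by linarith, hr.2.le⟩
    have hur := h.2.1 r ⟨by linarith, hr.2⟩
    rw [abs_of_nonpos h2]
    have h3 : -deriv u c ≤ u a / a := by
      rw [hce, ← neg_div, neg_sub]
      apply div_le_div₀ hua.le (by linarith) ha (by linarith [hr.1])
    linarith
  have hd2 : ∀ r ∈ Ico (2 * a) 1, |deriv (deriv u) r| ≤ u a * ((D + 1) / a ^ 2) := by
    intro r hr
    have hra : a ≤ r := by linarith [hr.1]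
    have h1 := hconv r ⟨hra, hr.2⟩
    have h2 := hd1 r hr
    have h4 := h.2.2.2.2.1 r ⟨by linarith, hr.2.le⟩
    have hur := h.2.1 r ⟨by linarith, hr.2⟩
    rw [abs_of_nonpos h4] at h2
    rw [abs_of_pos h1, h.convex_equation hLam hDdef ⟨by linarith, hr.2⟩ h1]
    have h3 : 0 < u r ^ q / Lam := by positivity
    have h5 : -deriv u r / r ≤ (u a / a) / a :=
      div_le_div₀ (by positivity) h2 ha hra
    have h6 := mul_le_mul_of_nonneg_left h5 (by linarith : 0 ≤ D + 1)
    have h7 : (D + 1) * ((u a / a) / a) = u a * ((D + 1) / a ^ 2) := by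
      field_simp
    have h8 : (D + 1) * (-deriv u r / r) = -((D + 1) * (deriv u r / r)) := by ring
    linarith
  have hsub : ∀ r ∈ Ioo (2 * a) 1, r ∈ Ioo (0 : ℝ) 1 := fun r hr => ⟨by linarith [hr.1], hr.2⟩
  intro r hr
  have hur : u r ≤ u a := h.antitoneOn ⟨ha.le, by linarith⟩ ⟨by linarith [hr.1], hr.2⟩
    (by linarith [hr.1])
  have hb : |deriv u r| ≤ u a / a ∧ |deriv (deriv u) r| ≤ u a * ((D + 1) / a ^ 2) := by
    rcases hr.2.eq_or_lt with rfl | h1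
    · exact ⟨abs_deriv_le_of_left ha1 (by positivity)
        (fun t ht => (h.hasDerivAt (hsub t ht)).differentiableAt)
        (fun t ht => hd1 t (Ioo_subset_Ico_self ht)),
        abs_deriv_le_of_left ha1 (by positivity)
        (fun t ht => (h.hasDerivAt_deriv (hsub t ht)).differentiableAt)
        (fun t ht => hd2 t (Ioo_subset_Ico_self ht))⟩
    · exact ⟨hd1 r ⟨hr.1, h1⟩, hd2 r ⟨hr.1, h1⟩⟩
  have : u a * (1 + 1 / a + (D + 1) / a ^ 2) = u a + u a / a + u a * ((D + 1) / a ^ 2) := by ring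
  rw [this]
  linarith [hb.1, hb.2]

end IsDirichletSol

namespace IsEntireSol

variable {lam Lam Ntil P c1 R0 : ℝ} {N : ℕ} {U : ℝ → ℝ}

lemma hasDerivAt (h : IsEntireSol lam Lam N Ntil P c1 R0 U) {r : ℝ} (hr : 0 < r) :
    HasDerivAt U (deriv U r) r :=
  (hasDerivAt_deriv_of_contDiffOn h.1 (Ici_mem_nhds hr)).1

lemma hasDerivAt_deriv (h : IsEntireSol lam Lam N Ntil P c1 R0 U) {r : ℝ} (hr : 0 < r) :
    HasDerivAt (deriv U) (deriv (deriv U) r) r :=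
  (hasDerivAt_deriv_of_contDiffOn h.1 (Ici_mem_nhds hr)).2

lemma deriv_neg (h : IsEntireSol lam Lam N Ntil P c1 R0 U) {r : ℝ} (hr : 0 < r) :
    deriv U r < 0 := h.2.2.2.2.1 r hr

lemma pos (h : IsEntireSol lam Lam N Ntil P c1 R0 U) {r : ℝ} (hr : 0 ≤ r) :
    0 < U r := h.2.1 r hr

lemma equation (h : IsEntireSol lam Lam N Ntil P c1 R0 U) {r : ℝ} (hr : 0 < r) :
    Lam * max (deriv (deriv U) r) 0 + lam * min (deriv (deriv U) r) 0 +
      ((N : ℝ) - 1) * lam * (deriv U r / r) = -U r ^ P := by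
  have h1 := h.2.2.2.2.2.1 r hr
  rw [radialPucci_of_deriv_nonpos hr (h.deriv_neg hr).le] at h1
  linarith

lemma antitoneOn (h : IsEntireSol lam Lam N Ntil P c1 R0 U) : AntitoneOn U (Ici 0) := by
  refine antitoneOn_of_deriv_nonpos (convex_Ici 0) h.1.continuousOn ?_ ?_
  all_goals
    intro r hr
    rw [interior_Ici] at hr
  · exact (h.hasDerivAt hr).differentiableAt.differentiableWithinAt
  · exact (h.deriv_neg hr).le

lemma deriv_deriv_pos (h : IsEntireSol lam Lam N Ntil P c1 R0 U) {r : ℝ} (hr : R0 < r) :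
    0 < deriv (deriv U) r := h.2.2.2.2.2.2.2.2.2.1 r hr

lemma tendsto_rpow_mul (h : IsEntireSol lam Lam N Ntil P c1 R0 U) :
    Tendsto (fun r : ℝ => r ^ (Ntil - 2) * U r) atTop (nhds c1) :=
  h.2.2.2.2.2.2.2.2.2.2.2.1

lemma continuousOn_deriv (h : IsEntireSol lam Lam N Ntil P c1 R0 U) :
    ContinuousOn (deriv U) (Ici 0) := by
  intro r hr
  rcases (mem_Ici.1 hr).eq_or_lt with rfl | hr
  · have h1 := h.2.2.2.2.2.2.2.1 0 ⟨le_rfl, h.2.2.2.2.2.2.1⟩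
    exact (differentiableAt_of_deriv_ne_zero h1.ne).continuousAt.continuousWithinAt
  · exact (h.hasDerivAt_deriv hr).continuousAt.continuousWithinAt

/-- Fast decay forces the exponent above the Serrin exponent `Ñ / (Ñ - 2)`. -/
lemma serrin_lt (h : IsEntireSol lam Lam N Ntil P c1 R0 U) (hLam : 0 < Lam)
    (hNtil : Ntil = lam / Lam * ((N : ℝ) - 1) + 1) (hP : 1 < P) :
    2 < (Ntil - 2) * (P - 1) := by
  by_contra hcon
  push Not at hcon
  have hc1 : 0 < c1 := h.2.2.2.2.2.2.2.2.2.2.1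
  have hlim := h.2.2.2.2.2.2.2.2.2.2.2.2
  obtain ⟨R, hR⟩ := eventually_atTop.1
    (h.tendsto_rpow_mul.eventually (lt_mem_nhds (half_lt_self hc1)))
  set T := max (max R 1) (R0 + 1) with hT
  have hT1 : 1 ≤ T := (le_max_right _ _).trans (le_max_left _ _)
  have hTR : R ≤ T := (le_max_left _ _).trans (le_max_left _ _)
  have hTR0 : R0 < T := lt_of_lt_of_le (by linarith) (le_max_right _ _)
  set k := (c1 / 2) ^ P / Lam with hk
  have hk0 : 0 < k := by positivity
  have hd : ∀ r, T ≤ r → HasDerivAt (fun r => r ^ (Ntil - 1) * deriv U r + k * log r)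
      (-(r ^ (Ntil - 1) * U r ^ P / Lam) + k * r⁻¹) r := by
    intro r hr
    have hr0 : 0 < r := by linarith
    have h1 := ((hasDerivAt_rpow_const (p := Ntil - 1) (Or.inl hr0.ne')).mul
      (h.hasDerivAt_deriv hr0)).add ((hasDerivAt_log hr0.ne').const_mul k)
    refine h1.congr_deriv ?_
    congr 1
    have h2 := h.equation hr0
    have h3 := h.deriv_deriv_pos (hTR0.trans_le hr)
    rw [max_eq_left h3.le, min_eq_right h3.le] at h2
    rw [rpow_sub_one hr0.ne' (Ntil - 1), ← neg_eq_iff_eq_neg.2 h2,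
      show Ntil - 1 = lam / Lam * ((N : ℝ) - 1) by linarith]
    field_simp
    ring
  have hanti : AntitoneOn (fun r => r ^ (Ntil - 1) * deriv U r + k * log r) (Ici T) := by
    refine antitoneOn_of_deriv_nonpos (convex_Ici T)
      (fun r hr => (hd r hr).continuousAt.continuousWithinAt) ?_ ?_
    all_goals
      intro r hr
      have hr : T ≤ r := interior_subset hr
    · exact (hd r hr).differentiableAt.differentiableWithinAt
    · rw [(hd r hr).deriv]
      have hr0 : 0 < r := by linarith
      have h1 : (c1 / 2) ^ P ≤ (r ^ (Ntil - 2) * U r) ^ P := by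
        have := hR r (hTR.trans hr)
        gcongr
      rw [mul_rpow (by positivity) (h.pos hr0.le).le, ← rpow_mul hr0.le] at h1
      have h2 : r ^ (-1 : ℝ) * r ^ ((Ntil - 2) * P) ≤ r ^ (Ntil - 1) := by
        rw [← rpow_add hr0]
        exact rpow_le_rpow_of_exponent_le (hT1.trans hr) (by linarith)
      have hUP : 0 < U r ^ P := rpow_pos_of_pos (h.pos hr0.le) P
      have h3 : k * r⁻¹ ≤ r ^ (Ntil - 1) * U r ^ P / Lam := by
        calc k * r⁻¹ = r ^ (-1 : ℝ) * (c1 / 2) ^ P / Lam := by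
              rw [rpow_neg_one, hk]; ring
          _ ≤ r ^ (-1 : ℝ) * (r ^ ((Ntil - 2) * P) * U r ^ P) / Lam := by gcongr
          _ = r ^ (-1 : ℝ) * r ^ ((Ntil - 2) * P) * U r ^ P / Lam := by ring
          _ ≤ _ := by gcongr
      linarith
  have htop : Tendsto (fun r => r ^ (Ntil - 1) * deriv U r + k * log r) atTop atTop :=
    hlim.add_atTop (tendsto_log_atTop.const_mul_atTop hk0)
  obtain ⟨r, hr1, hr2⟩ := ((htop.eventually_gt_atTop
    (T ^ (Ntil - 1) * deriv U T + k * log T)).and (eventually_ge_atTop T)).exists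
  exact absurd (hanti self_mem_Ici hr2 hr2) (not_le.2 hr1)

lemma tendsto_scale_invariant (h : IsEntireSol lam Lam N Ntil P c1 R0 U) (hP : 1 < P)
    (hs : 2 < (Ntil - 2) * (P - 1)) :
    Tendsto (fun r : ℝ => r ^ 2 * U r ^ (P - 1) / Lam) atTop (nhds 0) := by
  have h1 := (h.tendsto_rpow_mul.rpow_const (p := P - 1) (Or.inr (by linarith))).mul
    (tendsto_rpow_neg_atTop (y := (Ntil - 2) * (P - 1) - 2) (by linarith))
  have h2 := h1.div_const Lam
  simp only [mul_zero, zero_div] at h2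
  refine h2.congr' ?_
  filter_upwards [eventually_gt_atTop 0] with r hr
  rw [mul_rpow (by positivity) (h.pos hr.le).le, ← rpow_mul hr.le, mul_right_comm, ← rpow_add hr]
  congr 2
  ring_nf
  norm_num

end IsEntireSol

/-- The factor by which the radial variable is stretched when normalizing `u 0` to `1`. -/
noncomputable def blowupRadius (q : ℝ) (u : ℝ → ℝ) : ℝ := u 0 ^ ((q - 1) / 2)

namespace IsDirichletSol

variable {lam Lam q P e Ntil c1 R0 r0 : ℝ} {N : ℕ} {u U : ℝ → ℝ}

lemma pos_zero (h : IsDirichletSol lam Lam N q u) : 0 < u 0 := h.2.1 0 ⟨le_rfl, one_pos⟩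

lemma blowupRadius_pos (h : IsDirichletSol lam Lam N q u) : 0 < blowupRadius q u :=
  rpow_pos_of_pos h.pos_zero _

lemma blowupRadius_sq (h : IsDirichletSol lam Lam N q u) :
    blowupRadius q u ^ 2 = u 0 ^ (q - 1) := by
  rw [blowupRadius, ← rpow_natCast, ← rpow_mul h.pos_zero.le]
  congr 1
  push_cast
  ring

lemma rescaled_equation (h : IsDirichletSol lam Lam N q u) {s : ℝ}
    (hs : s ∈ Ioo 0 (blowupRadius q u)) :
    Lam * max (deriv (deriv u) (s / blowupRadius q u) / (u 0 * blowupRadius q u ^ 2)) 0 +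
      lam * min (deriv (deriv u) (s / blowupRadius q u) / (u 0 * blowupRadius q u ^ 2)) 0 +
      ((N : ℝ) - 1) * lam * (deriv u (s / blowupRadius q u) / (u 0 * blowupRadius q u) / s)
      = -(u (s / blowupRadius q u) / u 0) ^ q := by
  have hρ := h.blowupRadius_pos
  have hα := h.pos_zero
  have hr : s / blowupRadius q u ∈ Ioo (0 : ℝ) 1 :=
    ⟨div_pos hs.1 hρ, (div_lt_one hρ).2 hs.2⟩
  have h1 := h.equation hr
  have hαq : u 0 ^ q = u 0 * blowupRadius q u ^ 2 := by
    rw [h.blowupRadius_sq, rpow_sub_one hα.ne']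
    field_simp
  have hc : 0 < u 0 * blowupRadius q u ^ 2 := by positivity
  rw [div_rpow (h.2.1 _ ⟨hr.1.le, hr.2⟩).le hα.le, hαq, ← neg_div, ← h1]
  have e1 : ∀ x : ℝ, max (x / (u 0 * blowupRadius q u ^ 2)) 0
      = max x 0 / (u 0 * blowupRadius q u ^ 2) := by
    intro x
    have := max_div_div_right hc.le x 0
    rwa [zero_div] at this
  have e2 : ∀ x : ℝ, min (x / (u 0 * blowupRadius q u ^ 2)) 0
      = min x 0 / (u 0 * blowupRadius q u ^ 2) := by
    intro x
    have := min_div_div_right hc.le x 0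
    rwa [zero_div] at this
  rw [e1, e2]
  have := hs.1
  field_simp

/-- Quantitative closeness of the rescaled solution to the entire solution. -/
lemma rescaled_close (h : IsDirichletSol lam Lam N (P - e) u) (hi : InflectionAt u r0)
    (hU : IsEntireSol lam Lam N Ntil P c1 R0 U) (hlam : 0 < lam) (hlL : lam ≤ Lam)
    (hN : 2 ≤ N) (he : 0 ≤ e) (hp : 1 < P - e) :
    ∀ s ∈ Ico 0 (blowupRadius (P - e) u),
      (u (s / blowupRadius (P - e) u) / u 0 - U s) ^ 2 +
      (deriv u (s / blowupRadius (P - e) u) / (u 0 * blowupRadius (P - e) u) - deriv U s) ^ 2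
      ≤ e ^ 2 * exp ((1 + P / lam + 1 / lam ^ 2) * s) := by
  have hρ := h.blowupRadius_pos
  have heq := fun s => h.rescaled_equation (s := s)
  set ρ := blowupRadius (P - e) u with hρdef
  have hα := h.pos_zero
  have hN' : (2 : ℝ) ≤ N := by exact_mod_cast hN
  have hmem : ∀ s ∈ Ioo 0 ρ, s / ρ ∈ Ioo (0 : ℝ) 1 := fun s hs =>
    ⟨div_pos hs.1 hρ, (div_lt_one hρ).2 hs.2⟩
  have hmaps : MapsTo (fun s => s / ρ) (Ico 0 ρ) (Ico 0 1) := fun s hs =>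
    ⟨div_nonneg hs.1 hρ.le, (div_lt_one hρ).2 hs.2⟩
  have hdiv : ContinuousOn (fun s : ℝ => s / ρ) (Ico 0 ρ) := by fun_prop
  have hu1c : ContinuousOn (deriv u) (Ico 0 1) := by
    intro r hr
    rcases hr.1.eq_or_lt with rfl | hr0
    · have h1 := hi.2.1 0 ⟨le_rfl, hi.1.1⟩
      exact (differentiableAt_of_deriv_ne_zero h1.ne).continuousAt.continuousWithinAt
    · exact (h.hasDerivAt_deriv ⟨hr0, hr.2⟩).continuousAt.continuousWithinAt
  refine radial_energy_le (k := (N : ℝ) - 1)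
    (v := fun s => u (s / ρ) / u 0) (v1 := fun s => deriv u (s / ρ) / (u 0 * ρ))
    (v2 := fun s => deriv (deriv u) (s / ρ) / (u 0 * ρ ^ 2)) (U2 := deriv (deriv U))
    hlam hlL (by linarith) he hp.le
    (((h.1.continuousOn.mono Ico_subset_Icc_self).comp hdiv hmaps).div_const _)
    ((hu1c.comp hdiv hmaps).div_const _)
    (hU.1.continuousOn.mono Ico_subset_Ici_self) (hU.continuousOn_deriv.mono Ico_subset_Ici_self)
    ?_ ?_ (fun r hr => hU.hasDerivAt hr.1) (fun r hr => hU.hasDerivAt_deriv hr.1)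
    ?_ ?_ ?_ ?_ heq (fun r hr => hU.equation hr.1)
  · intro s hs
    have h1 := (HasDerivAt.comp s (h.hasDerivAt (hmem s hs))
      ((hasDerivAt_id s).div_const ρ)).div_const (u 0)
    refine h1.congr_deriv ?_
    simp only [id]
    field_simp
  · intro s hs
    have h1 := (HasDerivAt.comp s (h.hasDerivAt_deriv (hmem s hs))
      ((hasDerivAt_id s).div_const ρ)).div_const (u 0 * ρ)
    refine h1.congr_deriv ?_
    simp only [id]
    field_simp
  · simp [hU.2.2.1, hα.ne']
  · simp [hU.2.2.2.1, h.2.2.2.1]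
  · intro s hs
    have h1 := hmem s hs
    have h2 := h.antitoneOn ⟨le_rfl, zero_le_one⟩ (Ioo_subset_Icc_self h1) h1.1.le
    exact ⟨div_nonneg (h.2.1 _ ⟨h1.1.le, h1.2⟩).le hα.le, (div_le_one hα).2 h2⟩
  · intro s hs
    refine ⟨(hU.pos hs.1.le).le, ?_⟩
    have := hU.antitoneOn self_mem_Ici hs.1.le hs.1.le
    rwa [hU.2.2.1] at this

lemma lt_blowupRadius (h : IsDirichletSol lam Lam N (P - e) u) (hi : InflectionAt u r0)
    (hU : IsEntireSol lam Lam N Ntil P c1 R0 U) (hlam : 0 < lam) (hlL : lam ≤ Lam)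
    (hN : 2 ≤ N) (he : 0 ≤ e) (hp : 1 < P - e) {S : ℝ}
    (hS : e ^ 2 * exp ((1 + P / lam + 1 / lam ^ 2) * S) < U S ^ 2) :
    S < blowupRadius (P - e) u := by
  by_contra hcon
  push Not at hcon
  have hρ := h.blowupRadius_pos
  have hclose := h.rescaled_close hi hU hlam hlL hN he hp
  set ρ := blowupRadius (P - e) u with hρdef
  have hP : 0 < P := by linarith
  have hlim : Tendsto (fun s => (u (s / ρ) / u 0 - U s) ^ 2) (nhdsWithin ρ (Iio ρ))
      (nhds ((0 - U ρ) ^ 2)) := by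
    have h1 : ContinuousWithinAt u (Icc 0 1) (ρ / ρ) := by
      rw [div_self hρ.ne']
      exact h.1.continuousOn 1 (right_mem_Icc.2 zero_le_one)
    have h2 : Tendsto (fun s : ℝ => s / ρ) (nhdsWithin ρ (Iio ρ))
        (nhdsWithin (ρ / ρ) (Icc 0 1)) := by
      refine tendsto_nhdsWithin_iff.2 ⟨?_, ?_⟩
      · exact ((continuous_id.div_const ρ).tendsto ρ).mono_left nhdsWithin_le_nhds
      · filter_upwards [Ioo_mem_nhdsLT hρ] with s hs
        exact ⟨div_nonneg hs.1.le hρ.le, (div_le_one hρ).2 hs.2.le⟩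
    have h3 := h1.tendsto.comp h2
    rw [div_self hρ.ne', h.2.2.1] at h3
    have h4 : Tendsto U (nhdsWithin ρ (Iio ρ)) (nhds (U ρ)) :=
      (hU.hasDerivAt hρ).continuousAt.tendsto.mono_left nhdsWithin_le_nhds
    have h5 := ((h3.div_const (u 0)).sub h4).pow 2
    rwa [zero_div] at h5
  have hle : (0 - U ρ) ^ 2 ≤ e ^ 2 * exp ((1 + P / lam + 1 / lam ^ 2) * S) := by
    refine le_of_tendsto hlim ?_
    filter_upwards [Ioo_mem_nhdsLT hρ] with s hs
    have h1 := hclose s ⟨hs.1.le, hs.2⟩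
    have h2 : e ^ 2 * exp ((1 + P / lam + 1 / lam ^ 2) * s)
        ≤ e ^ 2 * exp ((1 + P / lam + 1 / lam ^ 2) * S) := by
      have : s ≤ S := hs.2.le.trans hcon
      gcongr
    have h3 := sq_nonneg (deriv u (s / ρ) / (u 0 * ρ) - deriv U s)
    linarith
  have hUS : U S ≤ U ρ := hU.antitoneOn hρ.le (hρ.le.trans hcon) hcon
  have := hU.pos (hρ.le.trans hcon)
  nlinarith

end IsDirichletSol

/-- The rescaled solutions converge, with their first derivatives, to the entire solution, and
the stretching factor diverges. -/
lemma tendsto_rescaled {lam Lam : ℝ} {N : ℕ} {Ntil P c1 R0 : ℝ}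
    (hlam : 0 < lam) (hlL : lam ≤ Lam) (hN : 2 ≤ N)
    {U : ℝ → ℝ} (hU : IsEntireSol lam Lam N Ntil P c1 R0 U)
    {ε : ℕ → ℝ} (hε : ∀ n, 0 < ε n) (hε0 : Tendsto ε atTop (nhds 0)) (hpn : ∀ n, 1 < P - ε n)
    {u : ℕ → ℝ → ℝ} (hu : ∀ n, IsDirichletSol lam Lam N (P - ε n) (u n))
    {r0 : ℕ → ℝ} (hr0 : ∀ n, InflectionAt (u n) (r0 n)) {S : ℝ} (hS : 0 < S) :
    (∀ᶠ n in atTop, S < blowupRadius (P - ε n) (u n)) ∧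
    Tendsto (fun n => u n (S / blowupRadius (P - ε n) (u n)) / u n 0) atTop (nhds (U S)) ∧
    Tendsto (fun n => deriv (u n) (S / blowupRadius (P - ε n) (u n)) /
      (u n 0 * blowupRadius (P - ε n) (u n))) atTop (nhds (deriv U S)) := by
  have hlim : Tendsto (fun n => ε n ^ 2 * exp ((1 + P / lam + 1 / lam ^ 2) * S)) atTop
      (nhds 0) := by
    have := (hε0.pow 2).mul_const (exp ((1 + P / lam + 1 / lam ^ 2) * S))
    rwa [zero_pow two_ne_zero, zero_mul] at this
  have h1 : ∀ᶠ n in atTop, S < blowupRadius (P - ε n) (u n) := by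
    filter_upwards [hlim.eventually (gt_mem_nhds (pow_pos (hU.pos hS.le) 2))] with n hn
    exact (hu n).lt_blowupRadius (hr0 n) hU hlam hlL hN (hε n).le (hpn n) hn
  have hsq : ∀ {f : ℕ → ℝ} {c : ℝ},
      (∀ᶠ n in atTop, (f n - c) ^ 2 ≤ ε n ^ 2 * exp ((1 + P / lam + 1 / lam ^ 2) * S)) →
      Tendsto f atTop (nhds c) := by
    intro f c hf
    have h2 := (squeeze_zero' (Eventually.of_forall fun n => sq_nonneg _) hf hlim).sqrt
    simp only [sqrt_sq_eq_abs, sqrt_zero] at h2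
    exact tendsto_sub_nhds_zero_iff.1 ((tendsto_zero_iff_abs_tendsto_zero _).2 h2)
  refine ⟨h1, hsq ?_, hsq ?_⟩
  all_goals
    filter_upwards [h1] with n hn
    have h2 := (hu n).rescaled_close (hr0 n) hU hlam hlL hN (hε n).le (hpn n) S ⟨hS.le, hn⟩
  · exact (le_add_of_nonneg_right (sq_nonneg _)).trans h2
  · exact (le_add_of_nonneg_left (sq_nonneg _)).trans h2

/-- Convergence to zero in `C²_loc((0,1])` of the solutions `uₙ` of the subcritical
Dirichlet problems as `pₙ = p⋆ − εₙ → p⋆`. -/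
theorem stmt_4 (lam Lam : ℝ) (N : ℕ) (Ntil pstar c1 R0 : ℝ)
    (hlam : 0 < lam) (hlL : lam ≤ Lam) (hN : 2 ≤ N)
    (hNtil : Ntil = lam / Lam * ((N : ℝ) - 1) + 1) (hNtil2 : 2 < Ntil)
    (hpstar : 1 < pstar)
    (U : ℝ → ℝ) (hU : IsEntireSol lam Lam N Ntil pstar c1 R0 U)
    (hnonex : ¬ ∃ w : ℝ → ℝ, IsDirichletSol lam Lam N pstar w)
    (ε : ℕ → ℝ) (hε : ∀ n, 0 < ε n) (hε0 : Tendsto ε atTop (nhds 0))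
    (hpn : ∀ n, 1 < pstar - ε n)
    (u : ℕ → ℝ → ℝ) (hu : ∀ n, IsDirichletSol lam Lam N (pstar - ε n) (u n))
    (r0 : ℕ → ℝ) (hr0 : ∀ n, InflectionAt (u n) (r0 n)) :
    ∀ r1 ∈ Set.Ioo (0 : ℝ) 1, ∀ δ > 0, ∃ n0 : ℕ, ∀ n ≥ n0, ∀ r ∈ Set.Icc r1 1,
      u n r + |deriv (u n) r| + |deriv (deriv (u n)) r| < δ := by
  intro r1 hr1 δ hδ
  have hLam : 0 < Lam := hlam.trans_le hlL
  have hserrin := hU.serrin_lt hLam hNtil hpstar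
  have hscale := hU.tendsto_scale_invariant hpstar hserrin
  obtain ⟨D, hDN⟩ : ∃ D, D = Ntil - 2 := ⟨_, rfl⟩
  rw [← hDN] at hserrin
  have hD : 0 < D := by linarith
  have hDdef : D + 1 = lam / Lam * ((N : ℝ) - 1) := by linarith
  obtain ⟨g, hg⟩ : ∃ g, g = (D + 2) / pstar := ⟨_, rfl⟩
  have hp0 : 0 < pstar := by linarith
  have hg0 : 0 < g := by rw [hg]; positivity
  have hPg : pstar * g = D + 2 := by rw [hg]; field_simp
  have hgD : g < D := by rw [hg, div_lt_iff₀ hp0]; linarith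
  have hpg : 2 < (pstar - 1) * g := by linarith
  obtain ⟨m, hm⟩ : ∃ m, m = 2 / (2 * D + 3) := ⟨_, rfl⟩
  have hmD : m * (2 * D + 3) = 2 := by rw [hm]; field_simp
  have hm1 : m < 1 / (D + 1) := by
    rw [hm, div_lt_div_iff₀ (by linarith) (by linarith)]
    linarith
  obtain ⟨μ, hμ⟩ : ∃ μ, μ = (D - g) / 4 := ⟨_, rfl⟩
  have hμ0 : 0 < μ := by rw [hμ]; linarith
  obtain ⟨a, ha⟩ : ∃ a, a = r1 / 2 := ⟨_, rfl⟩
  have ha0 : 0 < a := by rw [ha]; linarith [hr1.1]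
  have ha1 : 2 * a < 1 := by rw [ha]; linarith [hr1.2]
  set C := 1 + 1 / a + (D + 1) / a ^ 2 with hC
  have hC0 : 0 < C := by positivity
  obtain ⟨δ', hδ'⟩ : ∃ δ', δ' = min 1 (δ / C) := ⟨_, rfl⟩
  have hδ0 : 0 < δ' := by rw [hδ']; positivity
  obtain ⟨κ, hκ0, hκ1, hκ2, hκ3⟩ : ∃ κ, 0 < κ ∧ κ < g * (D - g) ∧
      κ < 2 * μ * (1 / (2 * pstar) - m * κ) ∧ κ < a ^ 2 * δ' ^ (pstar - 1) / Lam := by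
    have e1 : ∀ᶠ κ : ℝ in nhds 0, κ < g * (D - g) :=
      gt_mem_nhds (mul_pos hg0 (by linarith))
    have e2 : ∀ᶠ κ : ℝ in nhds 0, κ < 2 * μ * (1 / (2 * pstar) - m * κ) := by
      refine ContinuousAt.eventually_lt (by fun_prop) (by fun_prop) ?_
      simp only [mul_zero, sub_zero]
      positivity
    have e3 : ∀ᶠ κ : ℝ in nhds 0, κ < a ^ 2 * δ' ^ (pstar - 1) / Lam :=
      gt_mem_nhds (by positivity)
    have e4 : ∀ᶠ κ : ℝ in nhdsWithin 0 (Ioi 0), 0 < κ := self_mem_nhdsWithin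
    exact (e4.and (((e1.and (e2.and e3))).filter_mono nhdsWithin_le_nhds)).exists
  obtain ⟨η, hη0, hηκ, hη⟩ : ∃ η, 0 < η ∧ η < κ ∧
      m * κ + g * (η / κ) ^ μ < κ / (D + 1) := by
    have e1 : ∀ᶠ η : ℝ in nhds 0, η < κ := gt_mem_nhds hκ0
    have e2 : ∀ᶠ η : ℝ in nhds 0, m * κ + g * (η / κ) ^ μ < κ / (D + 1) := by
      refine ContinuousAt.eventually_lt ?_ continuousAt_const ?_
      · have : ContinuousAt (fun η : ℝ => (η / κ) ^ μ) 0 :=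
          ContinuousAt.rpow_const (by fun_prop) (Or.inr hμ0.le)
        fun_prop
      · rw [zero_div, zero_rpow hμ0.ne', mul_zero, add_zero]
        calc m * κ < 1 / (D + 1) * κ := by gcongr
          _ = κ / (D + 1) := by ring
    have e4 : ∀ᶠ η : ℝ in nhdsWithin 0 (Ioi 0), 0 < η := self_mem_nhdsWithin
    exact (e4.and ((e1.and e2).filter_mono nhdsWithin_le_nhds)).exists
  obtain ⟨s, hsη, hsR, hs0⟩ := ((hscale.eventually (gt_mem_nhds hη0)).and
    ((eventually_gt_atTop R0).and (eventually_gt_atTop 0))).exists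
  obtain ⟨hρs, hv, hv1⟩ := tendsto_rescaled hlam hlL hN hU hε hε0 hpn hu hr0 hs0
  have hρa := (tendsto_rescaled hlam hlL hN hU hε hε0 hpn hu hr0 (div_pos hs0 ha0)).1
  have hp : Tendsto (fun n => pstar - ε n) atTop (nhds pstar) := by
    simpa using tendsto_const_nhds.sub hε0
  have hpg' : ∀ᶠ n in atTop, 2 < (pstar - ε n - 1) * g :=
    ((hp.sub_const 1).mul_const g).eventually (lt_mem_nhds hpg)
  have hz : ∀ᶠ n in atTop, s ^ 2 * (u n (s / blowupRadius (pstar - ε n) (u n)) / u n 0) ^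
      (pstar - ε n - 1) / Lam < η := by
    have h1 := hv.rpow (hp.sub_const 1) (Or.inl (hU.pos hs0.le).ne')
    exact ((h1.const_mul (s ^ 2)).div_const Lam).eventually (gt_mem_nhds hsη)
  have hcv : ∀ᶠ n in atTop, 0 < -(u n (s / blowupRadius (pstar - ε n) (u n)) / u n 0) ^
      (pstar - ε n) - ((N : ℝ) - 1) * lam * (deriv (u n) (s / blowupRadius (pstar - ε n) (u n)) /
      (u n 0 * blowupRadius (pstar - ε n) (u n)) / s) := by
    have h1 := (hv.rpow hp (Or.inl (hU.pos hs0.le).ne')).neg.sub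
      ((hv1.div_const s).const_mul (((N : ℝ) - 1) * lam))
    refine h1.eventually (lt_mem_nhds ?_)
    have h2 := hU.equation hs0
    have h3 := hU.deriv_deriv_pos hsR
    rw [max_eq_left h3.le, min_eq_right h3.le] at h2
    have := mul_pos hLam h3
    linarith
  obtain ⟨n0, hn0⟩ := eventually_atTop.1 (hρs.and (hρa.and (hpg'.and (hz.and hcv))))
  refine ⟨n0, fun n hn => ?_⟩
  obtain ⟨hρs, hρa, hpg', hz, hcv⟩ := hn0 n hn
  have h := hu n
  have hρ := h.blowupRadius_pos
  have hα := h.pos_zero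
  have hq := hpn n
  have heq := h.rescaled_equation ⟨hs0, hρs⟩
  have hsq := h.blowupRadius_sq
  set q := pstar - ε n with hqdef
  set ρ := blowupRadius q (u n) with hρdef
  have ht0 : 0 < s / ρ := div_pos hs0 hρ
  have hta : s / ρ ≤ a := by
    rw [div_lt_iff₀ ha0] at hρa
    rw [div_le_iff₀ hρ]
    linarith
  have ht1 : s / ρ < 1 := by linarith
  have hconv0 : 0 < deriv (deriv (u n)) (s / ρ) := by
    by_contra hcon
    push Not at hcon
    have h1 : deriv (deriv (u n)) (s / ρ) / (u n 0 * ρ ^ 2) ≤ 0 :=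
      div_nonpos_of_nonpos_of_nonneg hcon (by positivity)
    rw [max_eq_right h1, min_eq_left h1] at heq
    have := mul_nonpos_of_nonneg_of_nonpos hlam.le h1
    linarith
  have hr0t : r0 n < s / ρ := by
    by_contra hcon
    push Not at hcon
    rcases hcon.eq_or_lt with h1 | h1
    · rw [h1, (hr0 n).2.2.1] at hconv0
      exact lt_irrefl _ hconv0
    · exact lt_asymm hconv0 ((hr0 n).2.1 _ ⟨ht0.le, h1⟩)
  have hconv : ∀ r ∈ Ico (s / ρ) 1, 0 < deriv (deriv (u n)) r := fun r hr =>
    (hr0 n).2.2.2 r ⟨hr0t.trans_le hr.1, hr.2⟩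
  have hut : 0 < u n (s / ρ) := h.2.1 _ ⟨ht0.le, ht1⟩
  have hzt : (s / ρ) ^ 2 * u n (s / ρ) ^ (q - 1) / Lam ≤ η := by
    refine le_of_eq_of_le ?_ hz.le
    rw [div_rpow hut.le hα.le, ← hsq]
    field_simp
  have hza := h.scale_invariant_lt hLam hDdef hD hq (by linarith [hε n]) hg0 hPg.le hpg' hmD hμ0
    (by rw [hμ]; ring) hκ0 hκ1 hκ2 hηκ hη ht0 hta (by linarith)
    (fun r hr => hconv r ⟨hr.1, by linarith [hr.2]⟩) hzt
  have hua : u n a < δ' := by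
    by_contra hcon
    push Not at hcon
    have h1 : δ' ^ (pstar - 1) ≤ δ' ^ (q - 1) :=
      rpow_le_rpow_of_exponent_ge hδ0 (by rw [hδ']; exact min_le_left _ _) (by linarith [hε n])
    have h2 : δ' ^ (q - 1) ≤ u n a ^ (q - 1) := rpow_le_rpow hδ0.le hcon (by linarith)
    have h3 : a ^ 2 * δ' ^ (pstar - 1) / Lam ≤ a ^ 2 * u n a ^ (q - 1) / Lam := by
      gcongr
      exact h1.trans h2
    linarith
  intro r hr
  have hsum := h.sum_le hLam hDdef hD ha0 ha1 (fun r hr => hconv r ⟨hta.trans hr.1, hr.2⟩) r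
    ⟨by linarith [hr.1], hr.2⟩
  have h4 : u n a < δ / C := hua.trans_le (by rw [hδ']; exact min_le_right _ _)
  rw [lt_div_iff₀ hC0] at h4
  exact hsum.trans_lt h4
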